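/- arXiv:2409.09208 — 6 statements merged into one kernel-verified Lean document; each statement's English description precedes it below -/
import Mathlib

section
/- Let β, κ ∈ (0,1) and σ, δ > 0. Let τ, h, f : ℕ → ℝ be sequences such that h(k) ≥ 0 for all k, f is bounded below, and h(k+n) ≤ β·τ(k) for all k, n ∈ ℕ. Suppose that for every k one of the following holds: (h-type step) h(k+1) ≤ β·τ(k) and τ(k+1) = (1−κ)·h(k+1) + κ·τ(k); or (f-type step) τ(k+1) = τ(k) and f(k) − f(k+1) ≥ σ·δ·(h(k))². Then h(k) → 0 as k → ∞. -/
open Filter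

/-- Convergence to feasibility of the funnel method: `h k` is the constraint
violation, `f k` the objective value, `τ k` the funnel width. Each iteration is
either an h-type step (`h (k+1) ≤ β * τ k` and the funnel update
`τ (k+1) = (1-κ) * h (k+1) + κ * τ k`) or an f-type step (`τ (k+1) = τ k` and
`f k - f (k+1) ≥ σ * δ * (h k)^2`). Then `h k → 0`. -/
theorem funnel_convergence_to_feasibility (β κ σ δ : ℝ)
    (hβ : β ∈ Set.Ioo (0 : ℝ) 1) (hκ : κ ∈ Set.Ioo (0 : ℝ) 1)
    (hσ : 0 < σ) (hδ : 0 < δ)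
    (τ h f : ℕ → ℝ)
    (hh : ∀ k, 0 ≤ h k)
    (hbdd : BddBelow (Set.range f))
    (hfunnel : ∀ k n : ℕ, h (k + n) ≤ β * τ k)
    (hstep : ∀ k : ℕ,
      (h (k + 1) ≤ β * τ k ∧ τ (k + 1) = (1 - κ) * h (k + 1) + κ * τ k) ∨
      (τ (k + 1) = τ k ∧ σ * δ * (h k) ^ 2 ≤ f k - f (k + 1))) :
    Tendsto h atTop (nhds 0) := by
  obtain ⟨hβ0, hβ1⟩ := hβ
  obtain ⟨hκ0, hκ1⟩ := hκ
  have hτ0 : ∀ k, 0 ≤ τ k := fun k => by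
    have h1 := (hh k).trans (hfunnel k 0)
    exact nonneg_of_mul_nonneg_right h1 hβ0
  have hc : 0 < (1 - κ) * (1 - β) := mul_pos (by linarith) (by linarith)
  have hdec : ∀ k, h (k + 1) ≤ β * τ k → τ (k + 1) = (1 - κ) * h (k + 1) + κ * τ k →
      (1 - κ) * (1 - β) * τ k ≤ τ k - τ (k + 1) := fun k h1 h2 => by
    have h3 := mul_le_mul_of_nonneg_left h1 (by linarith : 0 ≤ 1 - κ)
    rw [h2]
    linarith
  have hanti : Antitone τ := antitone_nat_of_succ_le fun k => by
    rcases hstep k with ⟨h1, h2⟩ | ⟨h1, _⟩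
    · have h3 := hdec k h1 h2
      have h4 := mul_nonneg hc.le (hτ0 k)
      linarith
    · exact h1.le
  have hτb : BddBelow (Set.range τ) := ⟨0, by rintro _ ⟨k, rfl⟩; exact hτ0 k⟩
  have hlim := tendsto_atTop_ciInf hanti hτb
  have hLle : ∀ k, (⨅ i, τ i) ≤ τ k := fun k => ciInf_le hτb k
  have hL0 : 0 ≤ ⨅ i, τ i := le_ciInf hτ0
  generalize (⨅ i, τ i) = L at hlim hLle hL0
  rcases hL0.eq_or_lt with hL | hL
  · subst hL
    have h1 : Tendsto (fun k => β * τ k) atTop (nhds 0) := by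
      simpa using hlim.const_mul β
    exact squeeze_zero hh (fun k => hfunnel k 0) h1
  · have hdiff : Tendsto (fun k => τ k - τ (k + 1)) atTop (nhds 0) := by
      simpa using hlim.sub (hlim.comp (tendsto_add_atTop_nat 1))
    have hev := hdiff.eventually_lt_const (mul_pos hc hL)
    obtain ⟨N, hN⟩ := eventually_atTop.1 hev
    have hf : ∀ k, N ≤ k → σ * δ * (h k) ^ 2 ≤ f k - f (k + 1) := fun k hk => by
      rcases hstep k with ⟨h1, h2⟩ | ⟨_, h2⟩
      · have h3 := hdec k h1 h2
        have h4 := hN k hk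
        have h5 := mul_le_mul_of_nonneg_left (hLle k) hc.le
        linarith
      · exact h2
    have hσδ : 0 < σ * δ := mul_pos hσ hδ
    have hfa : Antitone (fun k => f (k + N)) := antitone_nat_of_succ_le fun k => by
      have h1 := hf (k + N) (by omega)
      have h2 : 0 ≤ σ * δ * (h (k + N)) ^ 2 := by positivity
      have h3 : k + 1 + N = k + N + 1 := by omega
      rw [h3]
      linarith
    have hfb : BddBelow (Set.range (fun k => f (k + N))) :=
      hbdd.mono (by rintro _ ⟨k, rfl⟩; exact ⟨_, rfl⟩)
    have hfl := (tendsto_add_atTop_iff_nat N).1 (tendsto_atTop_ciInf hfa hfb)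
    have hfd : Tendsto (fun k => (f k - f (k + 1)) / (σ * δ)) atTop (nhds 0) := by
      simpa using (hfl.sub (hfl.comp (tendsto_add_atTop_nat 1))).div_const (σ * δ)
    have hsq : Tendsto (fun k => (h k) ^ 2) atTop (nhds 0) := by
      refine squeeze_zero' (Eventually.of_forall fun k => sq_nonneg _) ?_ hfd
      filter_upwards [eventually_ge_atTop N] with k hk
      rw [le_div_iff₀ hσδ]
      linarith [hf k hk]
    have h1 := hsq.sqrt
    simpa [Real.sqrt_sq (hh _)] using h1
end

section
/- Let φ : ℝ → ℝ be the quadratic function φ(α) = a + b·α + (c/2)·α² with φ'(0) = b < 0. Then α = 1 is a minimizer of φ over the interval [0,1] if and only if b + c ≤ 0 (i.e., φ'' + φ'(0) ≤ 0); and in that case φ(0) − φ(1) ≥ −b/2 = −φ'(0)/2. -/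
/-- One-dimensional quadratic minimization lemma (Fletcher–Leyffer–Toint):
for `φ(α) = a + b·α + (c/2)·α²` with `φ'(0) = b < 0`, the point `α = 1`
minimizes `φ` over `[0,1]` if and only if `b + c ≤ 0`, and in that case
`φ(0) - φ(1) ≥ -b/2`. -/
theorem quadratic_1d_minimization (a b c : ℝ) (φ : ℝ → ℝ)
    (hφ : ∀ α : ℝ, φ α = a + b * α + (c / 2) * α ^ 2)
    (hb : b < 0) :
    ((∀ α ∈ Set.Icc (0 : ℝ) 1, φ 1 ≤ φ α) ↔ b + c ≤ 0) ∧
      (b + c ≤ 0 → -b / 2 ≤ φ 0 - φ 1) := by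
  refine ⟨⟨fun h => ?_, fun h α hα => ?_⟩, fun h => ?_⟩
  · by_contra hc
    have hc1 : 0 < b + c := not_le.mp hc
    have hc0 : 0 < c := by linarith
    have h0 : 0 ≤ -b / c := div_nonneg (by linarith) hc0.le
    have h1 : -b / c < 1 := by rw [div_lt_one hc0]; linarith
    have hm := h (-b / c) ⟨h0, h1.le⟩
    have hbc : b = -(c * (-b / c)) := by field_simp
    rw [hφ, hφ] at hm
    generalize -b / c = t at *
    subst hbc
    have : 0 < c * (1 - t) ^ 2 := mul_pos hc0 (pow_pos (by linarith) 2)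
    nlinarith
  · obtain ⟨h0, h1⟩ := hα
    rw [hφ, hφ]
    have e1 : 0 ≤ (1 - α) * (1 + α) * (-(b + c)) :=
      mul_nonneg (mul_nonneg (by linarith) (by linarith)) (by linarith)
    have e2 : 0 ≤ (1 - α) ^ 2 * (-b) := mul_nonneg (sq_nonneg _) (by linarith)
    nlinarith
  · rw [hφ, hφ]
    linarith
end

section
/- Let n ≥ 1, let f : ℝⁿ → ℝ be twice continuously differentiable, let x, d ∈ ℝⁿ, let W be a continuous linear map on ℝⁿ with operator norm ‖W‖ ≤ M, and let M > 0, Δ ≥ 0. Suppose ‖∇²f(z)‖ ≤ M for every z on the line segment from x to x + d, and ‖d‖∞ ≤ Δ. Then the actual objective reduction dominates the predicted reduction up to a trust-region error term: f(x) − f(x + d) ≥ (−(1/2)·⟪d, W d⟫ − ⟪∇f(x), d⟫) − n·Δ²·M. -/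
open RealInnerProductSpace

/-- Actual versus predicted reduction for the quadratic objective model: if `f`
is `C²` with Hessian operator norm at most `M` on the segment from `x` to
`x + d`, `‖W‖ ≤ M`, and `‖d‖∞ ≤ Δ`, then the actual reduction
`f x - f (x + d)` dominates the predicted reduction
`-(1/2)⟪d, W d⟫ - ⟪∇f x, d⟫` up to the error term `n Δ² M`. -/
theorem actual_vs_predicted_reduction (n : ℕ) (hn : 1 ≤ n)
    (f : EuclideanSpace ℝ (Fin n) → ℝ) (hf : ContDiff ℝ 2 f)
    (x d : EuclideanSpace ℝ (Fin n))
    (W : EuclideanSpace ℝ (Fin n) →L[ℝ] EuclideanSpace ℝ (Fin n))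
    (M Δ : ℝ) (hM : 0 < M) (hΔ : 0 ≤ Δ) (hW : ‖W‖ ≤ M)
    (hHess : ∀ z ∈ segment ℝ x (x + d), ‖fderiv ℝ (gradient f) z‖ ≤ M)
    (hd : ∀ i, |d i| ≤ Δ) :
    (-(1 / 2) * ⟪d, W d⟫ - ⟪gradient f x, d⟫) - n * Δ ^ 2 * M ≤
      f x - f (x + d) := by
  have hf1 : Differentiable ℝ f := hf.differentiable (by norm_num)
  have hgd : Differentiable ℝ (gradient f) := by
    have h1 : ContDiff ℝ 1 (fderiv ℝ f) := hf.fderiv_right (by norm_num)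
    have h2 : Differentiable ℝ (fderiv ℝ f) := h1.differentiable (by norm_num)
    exact ((InnerProductSpace.toDual ℝ (EuclideanSpace ℝ (Fin n))).symm.toContinuousLinearEquiv.differentiable).comp h2
  have hseg : ∀ t ∈ Set.Icc (0 : ℝ) 1, x + t • d ∈ segment ℝ x (x + d) := by
    intro t ht
    rw [segment_eq_image']
    exact ⟨t, ht, by simp⟩
  have hlip : ∀ t ∈ Set.Icc (0 : ℝ) 1,
      ‖gradient f (x + t • d) - gradient f x‖ ≤ M * (t * ‖d‖) := by
    intro t ht
    have := (convex_segment (𝕜 := ℝ) x (x + d)).norm_image_sub_le_of_norm_fderiv_le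
      (fun z _ => hgd z) hHess (left_mem_segment ℝ x (x + d)) (hseg t ht)
    simpa [norm_smul, abs_of_nonneg ht.1] using this
  have hder : ∀ t : ℝ, HasDerivAt (fun t : ℝ => t * ⟪gradient f x, d⟫ + M * ‖d‖ ^ 2 / 2 * t ^ 2
      - f (x + t • d)) (⟪gradient f x, d⟫ + M * ‖d‖ ^ 2 * t - ⟪gradient f (x + t • d), d⟫) t := by
    intro t
    have h1 : HasDerivAt (fun t : ℝ => x + t • d) d t := by
      simpa using ((hasDerivAt_id t).smul_const d).const_add x
    have h2 := ((hf1 (x + t • d)).hasGradientAt.hasFDerivAt).comp_hasDerivAt t h1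
    have h3 := (((hasDerivAt_id t).mul_const ⟪gradient f x, d⟫).add
      ((hasDerivAt_pow 2 t).const_mul (M * ‖d‖ ^ 2 / 2))).sub h2
    refine h3.congr_deriv ?_
    simp
    ring
  have hmono : MonotoneOn (fun t : ℝ => t * ⟪gradient f x, d⟫ + M * ‖d‖ ^ 2 / 2 * t ^ 2
      - f (x + t • d)) (Set.Icc 0 1) := by
    refine monotoneOn_of_deriv_nonneg (convex_Icc 0 1)
      (fun t _ => (hder t).continuousAt.continuousWithinAt)
      (fun t _ => (hder t).differentiableAt.differentiableWithinAt) ?_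
    intro t ht
    rw [(hder t).deriv]
    have ht' := interior_subset ht
    have h1 := real_inner_le_norm (gradient f (x + t • d) - gradient f x) d
    rw [inner_sub_left] at h1
    have h2 := mul_le_mul_of_nonneg_right (hlip t ht') (norm_nonneg d)
    nlinarith
  have key := hmono (Set.left_mem_Icc.2 zero_le_one) (Set.right_mem_Icc.2 zero_le_one) zero_le_one
  have hg : ⟪gradient f x, d⟫ = fderiv ℝ f x d := by simp
  simp at key
  rw [← hg] at key
  have hWd : -(M * ‖d‖ ^ 2) ≤ ⟪d, W d⟫ := by
    have h1 := abs_real_inner_le_norm d (W d)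
    have h2 := W.le_of_opNorm_le hW d
    have h3 := mul_le_mul_of_nonneg_left h2 (norm_nonneg d)
    have h4 := neg_abs_le ⟪d, W d⟫
    nlinarith
  have hdn : ‖d‖ ^ 2 ≤ n * Δ ^ 2 := by
    rw [EuclideanSpace.norm_sq_eq]
    calc ∑ i, ‖d i‖ ^ 2 ≤ ∑ _i : Fin n, Δ ^ 2 :=
          Finset.sum_le_sum fun i _ => pow_le_pow_left₀ (norm_nonneg _) (hd i) 2
      _ = n * Δ ^ 2 := by simp
  have h5 := mul_le_mul_of_nonneg_right hdn hM.le
  nlinarith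
end

section
/- Let n, m ≥ 1, let c₁, …, c_m : ℝⁿ → ℝ be twice continuously differentiable, let x, d ∈ ℝⁿ, let M > 0, let β ∈ (0,1), and let τ > 0. Suppose for each i that ‖∇²c_i(z)‖ ≤ M for every z on the line segment from x to x + d, that c_i(x) + ⟪∇c_i(x), d⟫ = 0, and that ‖d‖∞ ≤ Δ, where Δ ≥ 0 satisfies Δ² ≤ 2·β·τ/(m·n·M). Then ∑_{i=1}^{m} |c_i(x + d)| ≤ β·τ; i.e., the trial point x + d satisfies the funnel sufficient-decrease condition h(x+d) ≤ βτ. -/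
open RealInnerProductSpace

lemma taylor_aux {n : ℕ} (c : EuclideanSpace ℝ (Fin n) → ℝ) (hc : ContDiff ℝ 2 c)
    (x d : EuclideanSpace ℝ (Fin n)) (M : ℝ) (hM : 0 < M)
    (hH : ∀ z ∈ segment ℝ x (x + d), ‖fderiv ℝ (gradient c) z‖ ≤ M)
    (hlin : c x + ⟪gradient c x, d⟫ = 0) : |c (x + d)| ≤ M * ‖d‖ ^ 2 / 2 := by
  have hdc : Differentiable ℝ c := hc.differentiable (by norm_num)
  have hg : Differentiable ℝ (gradient c) := by
    have h1 : Differentiable ℝ (fderiv ℝ c) :=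
      (hc.fderiv_right (m := 1) (by norm_num)).differentiable (by norm_num)
    have h2 : Differentiable ℝ
        (InnerProductSpace.toDual ℝ (EuclideanSpace ℝ (Fin n))).symm :=
      (InnerProductSpace.toDual ℝ (EuclideanSpace ℝ (Fin n))).symm.differentiable
    exact h2.comp h1
  have hseg : ∀ t ∈ Set.Icc (0 : ℝ) 1, x + t • d ∈ segment ℝ x (x + d) := by
    intro t ht
    rw [segment_eq_image']
    exact ⟨t, ht, by simp⟩
  have hlip : ∀ t ∈ Set.Icc (0 : ℝ) 1,
      ‖gradient c (x + t • d) - gradient c x‖ ≤ M * (t * ‖d‖) := by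
    intro t ht
    have := (convex_segment x (x + d)).norm_image_sub_le_of_norm_fderiv_le (𝕜 := ℝ)
      (fun z _ => hg z) hH (left_mem_segment ℝ x (x + d)) (hseg t ht)
    simpa [norm_smul, abs_of_nonneg ht.1] using this
  have hder : ∀ t : ℝ, HasDerivAt (fun t : ℝ => c (x + t • d) - c x - t * ⟪gradient c x, d⟫)
      (⟪gradient c (x + t • d) - gradient c x, d⟫) t := by
    intro t
    have h1 : HasDerivAt (fun t : ℝ => x + t • d) d t := by
      simpa using ((hasDerivAt_id t).smul_const d).const_add x
    have h2 := (hdc (x + t • d)).hasGradientAt.hasFDerivAt.comp_hasDerivAt t h1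
    have h3 := (h2.sub_const (c x)).sub
      ((hasDerivAt_id t).mul_const (⟪gradient c x, d⟫))
    rw [inner_sub_left]
    refine HasDerivAt.congr_deriv (f := fun t : ℝ => c (x + t • d) - c x - t * ⟪gradient c x, d⟫) h3 ?_
    simp
  have key := image_norm_le_of_norm_deriv_right_le_deriv_boundary (a := 0) (b := 1)
    (f := fun t : ℝ => c (x + t • d) - c x - t * ⟪gradient c x, d⟫)
    (B := fun t => M * ‖d‖ ^ 2 / 2 * t ^ 2) (B' := fun t => M * ‖d‖ ^ 2 * t)
    (fun t _ => (hder t).continuousAt.continuousWithinAt)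
    (fun t _ => (hder t).hasDerivWithinAt) (by simp)
    (fun t => by
      have := (hasDerivAt_pow 2 t).const_mul (M * ‖d‖ ^ 2 / 2)
      refine this.congr_deriv ?_
      norm_num
      ring)
    (fun t ht => by
      refine (norm_inner_le_norm _ _).trans ?_
      have := mul_le_mul_of_nonneg_right (hlip t ⟨ht.1, ht.2.le⟩) (norm_nonneg d)
      linarith) (Set.right_mem_Icc.2 zero_le_one)
  simp only [one_smul, one_mul, one_pow, mul_one, Real.norm_eq_abs] at key
  rwa [sub_sub, hlin, sub_zero] at key

/-- Funnel sufficient-decrease from a small trust region: if each constraint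
`c i` is `C²` with Hessian operator norm at most `M` on the segment from `x` to
`x + d`, the step `d` satisfies each linearized constraint and the ℓ∞
trust-region bound `‖d‖∞ ≤ Δ` with `Δ² ≤ 2βτ/(m n M)`, then the trial point
satisfies the funnel condition `∑ i, |c i (x + d)| ≤ β * τ`. -/
theorem funnel_acceptable_of_small_radius (n m : ℕ) (hn : 1 ≤ n) (hm : 1 ≤ m)
    (c : Fin m → EuclideanSpace ℝ (Fin n) → ℝ)
    (hc : ∀ i, ContDiff ℝ 2 (c i))
    (x d : EuclideanSpace ℝ (Fin n)) (M β τ Δ : ℝ)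
    (hM : 0 < M) (hβ : β ∈ Set.Ioo (0 : ℝ) 1) (hτ : 0 < τ) (hΔ : 0 ≤ Δ)
    (hHess : ∀ i, ∀ z ∈ segment ℝ x (x + d), ‖fderiv ℝ (gradient (c i)) z‖ ≤ M)
    (hlin : ∀ i, c i x + ⟪gradient (c i) x, d⟫ = 0)
    (hd : ∀ j, |d j| ≤ Δ)
    (hΔτ : Δ ^ 2 ≤ 2 * β * τ / (m * n * M)) :
    ∑ i, |c i (x + d)| ≤ β * τ := by
  have hn' : (0 : ℝ) < n := by exact_mod_cast hn
  have hm' : (0 : ℝ) < m := by exact_mod_cast hm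
  have hnd : ‖d‖ ^ 2 ≤ n * Δ ^ 2 := by
    rw [EuclideanSpace.norm_sq_eq]
    calc ∑ j, ‖d j‖ ^ 2 ≤ ∑ _j : Fin n, Δ ^ 2 :=
          Finset.sum_le_sum fun j _ => pow_le_pow_left₀ (norm_nonneg _) (hd j) 2
      _ = n * Δ ^ 2 := by simp
  rw [le_div_iff₀ (by positivity)] at hΔτ
  calc ∑ i, |c i (x + d)| ≤ ∑ _i : Fin m, M * ‖d‖ ^ 2 / 2 :=
        Finset.sum_le_sum fun i _ => taylor_aux (c i) (hc i) x d M hM (hHess i) (hlin i)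
    _ = m * M / 2 * ‖d‖ ^ 2 := by simp; ring
    _ ≤ m * M / 2 * (n * Δ ^ 2) := by gcongr
    _ ≤ β * τ := by linarith
end

section
/- Let n ≥ 1, let f : ℝⁿ → ℝ be twice continuously differentiable, let x, d ∈ ℝⁿ, let W be a continuous linear map on ℝⁿ with operator norm ‖W‖ ≤ M where M > 0, let σ ∈ (0,1), let η > 0, and let Δ > 0 with Δ ≤ (1−σ)·η/(2·n·M). Suppose ‖∇²f(z)‖ ≤ M for every z on the line segment from x to x + d, that ‖d‖∞ ≤ Δ, and that the predicted reduction Δm_f(d) := −(1/2)·⟪d, W d⟫ − ⟪∇f(x), d⟫ satisfies Δm_f(d) ≥ (1/2)·Δ·η. Then the Armijo sufficient-decrease condition holds: f(x) − f(x + d) ≥ σ·Δm_f(d) > 0. -/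
open RealInnerProductSpace

/-- Armijo sufficient decrease for small trust-region radii: if `f` is `C²`
with Hessian operator norm at most `M` on the segment from `x` to `x + d`,
`‖W‖ ≤ M`, `‖d‖∞ ≤ Δ` with `0 < Δ ≤ (1-σ)η/(2nM)`, and the predicted
reduction `Δm_f(d) = -(1/2)⟪d, W d⟫ - ⟪∇f x, d⟫` satisfies
`Δm_f(d) ≥ (1/2)Δη`, then the Armijo condition holds:
`f x - f (x + d) ≥ σ · Δm_f(d) > 0`. -/
theorem armijo_of_small_radius (n : ℕ) (hn : 1 ≤ n)
    (f : EuclideanSpace ℝ (Fin n) → ℝ) (hf : ContDiff ℝ 2 f)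
    (x d : EuclideanSpace ℝ (Fin n))
    (W : EuclideanSpace ℝ (Fin n) →L[ℝ] EuclideanSpace ℝ (Fin n))
    (M σ η Δ : ℝ)
    (hM : 0 < M) (hW : ‖W‖ ≤ M)
    (hσ : σ ∈ Set.Ioo (0 : ℝ) 1) (hη : 0 < η)
    (hΔpos : 0 < Δ) (hΔle : Δ ≤ (1 - σ) * η / (2 * n * M))
    (hHess : ∀ z ∈ segment ℝ x (x + d), ‖fderiv ℝ (gradient f) z‖ ≤ M)
    (hd : ∀ i, |d i| ≤ Δ)
    (hpred : (1 / 2) * Δ * η ≤ -(1 / 2) * ⟪d, W d⟫ - ⟪gradient f x, d⟫) :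
    σ * (-(1 / 2) * ⟪d, W d⟫ - ⟪gradient f x, d⟫) ≤ f x - f (x + d) ∧
      0 < σ * (-(1 / 2) * ⟪d, W d⟫ - ⟪gradient f x, d⟫) := by
  have hdiff : Differentiable ℝ f := hf.differentiable (by norm_num)
  have hgd : Differentiable ℝ (gradient f) := by
    have h1 : ContDiff ℝ 1 (fderiv ℝ f) := hf.fderiv_right (by norm_num)
    have h2 := h1.differentiable (by norm_num)
    unfold gradient
    exact (InnerProductSpace.toDual ℝ (EuclideanSpace ℝ (Fin n))).symm.toContinuousLinearEquiv.differentiable.comp h2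
  have hlip : ∀ t ∈ Set.Icc (0:ℝ) 1,
      ‖gradient f (x + t • d) - gradient f x‖ ≤ M * (t * ‖d‖) := by
    intro t ht
    have hmem : x + t • d ∈ segment ℝ x (x + d) := by
      rw [segment_eq_image']
      exact ⟨t, ht, by simp⟩
    have := (convex_segment x (x + d)).norm_image_sub_le_of_norm_fderiv_le
      (fun z _ => hgd z) hHess (left_mem_segment ℝ x (x + d)) hmem
    simpa [norm_smul, abs_of_nonneg ht.1] using this
  have hline : ∀ t : ℝ, HasDerivAt (fun t : ℝ => x + t • d) d t := by
    intro t
    simpa using ((hasDerivAt_id t).smul_const d).const_add x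
  have hφ : ∀ t : ℝ, HasDerivAt (fun t : ℝ => f (x + t • d))
      ⟪gradient f (x + t • d), d⟫ t := by
    intro t
    have h1 := (hdiff (x + t • d)).hasGradientAt.hasFDerivAt
    exact h1.comp_hasDerivAt t (hline t)
  have hB : ∀ t : ℝ, HasDerivAt
      (fun t : ℝ => f x + t * ⟪gradient f x, d⟫ + M / 2 * ‖d‖ ^ 2 * t ^ 2)
      (⟪gradient f x, d⟫ + M * ‖d‖ ^ 2 * t) t := by
    intro t
    have h := (((hasDerivAt_id t).mul_const ⟪gradient f x, d⟫).const_add (f x)).add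
      (((hasDerivAt_id t).pow 2).const_mul (M / 2 * ‖d‖ ^ 2))
    refine HasDerivAt.congr_deriv h ?_
    simp
    ring
  have key := image_le_of_deriv_right_le_deriv_boundary (a := 0) (b := 1)
    (f := fun t : ℝ => f (x + t • d))
    (fun t _ => (hφ t).continuousAt.continuousWithinAt)
    (fun t _ => (hφ t).hasDerivWithinAt)
    (B := fun t : ℝ => f x + t * ⟪gradient f x, d⟫ + M / 2 * ‖d‖ ^ 2 * t ^ 2)
    (by simp)
    (fun t _ => (hB t).continuousAt.continuousWithinAt)
    (fun t _ => (hB t).hasDerivWithinAt)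
    (by
      intro t ht
      have h1 := hlip t ⟨ht.1, ht.2.le⟩
      have h2 := real_inner_le_norm (gradient f (x + t • d) - gradient f x) d
      rw [inner_sub_left] at h2
      have h3 := mul_le_mul_of_nonneg_right h1 (norm_nonneg d)
      nlinarith)
    (Set.right_mem_Icc.2 zero_le_one)
  simp only [one_smul, one_mul, one_pow, mul_one] at key
  have hdn : ‖d‖ ^ 2 ≤ n * Δ ^ 2 := by
    rw [EuclideanSpace.norm_sq_eq]
    calc ∑ i, ‖d i‖ ^ 2 ≤ ∑ _i : Fin n, Δ ^ 2 :=
          Finset.sum_le_sum fun i _ => pow_le_pow_left₀ (norm_nonneg _) (hd i) 2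
      _ = n * Δ ^ 2 := by simp
  have hWd : -(M * ‖d‖ ^ 2) ≤ ⟪d, W d⟫ := by
    have h1 := abs_real_inner_le_norm d (W d)
    have h2 : ‖W d‖ ≤ M * ‖d‖ := W.le_of_opNorm_le hW d
    have h3 := mul_le_mul_of_nonneg_left h2 (norm_nonneg d)
    have h4 := neg_abs_le ⟪d, W d⟫
    nlinarith
  have hn' : (0 : ℝ) < n := by exact_mod_cast hn
  rw [le_div_iff₀ (by positivity)] at hΔle
  obtain ⟨hσ0, hσ1⟩ := hσ
  set P := -(1 / 2) * ⟪d, W d⟫ - ⟪gradient f x, d⟫ with hP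
  have hpos : 0 < P := lt_of_lt_of_le (by positivity) hpred
  refine ⟨?_, mul_pos hσ0 hpos⟩
  have e1 := mul_le_mul_of_nonneg_left hΔle hΔpos.le
  have e2 := mul_le_mul_of_nonneg_left hpred (sub_nonneg.2 hσ1.le)
  have e3 := mul_le_mul_of_nonneg_left hdn hM.le
  linarith
end

section
/- Let β, κ ∈ (0,1) and let τ, h : ℕ → ℝ be sequences with h(k) ≥ 0 and h(k+1) ≤ β·τ(k) for all k. Suppose that for every k the funnel update τ(k+1) = (1−κ)·h(k+1) + κ·τ(k) is performed. Then τ(k+1) ≤ θ·τ(k) for all k with θ := 1 − (1−β)(1−κ) ∈ (0,1), and consequently both τ(k) → 0 and h(k) → 0 as k → ∞. -/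
open Filter

/-- All-h-type-steps case of the convergence-to-feasibility proof: if
`h k ≥ 0`, the funnel condition `h (k+1) ≤ β * τ k` holds and the funnel update
`τ (k+1) = (1-κ) h (k+1) + κ τ k` is performed at every iteration, then
`τ (k+1) ≤ θ τ k` with `θ = 1 - (1-β)(1-κ) ∈ (0,1)`, and consequently
`τ k → 0` and `h k → 0`. -/
theorem funnel_all_h_type_steps (β κ : ℝ)
    (hβ : β ∈ Set.Ioo (0 : ℝ) 1) (hκ : κ ∈ Set.Ioo (0 : ℝ) 1)
    (τ h : ℕ → ℝ)
    (hh : ∀ k, 0 ≤ h k)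
    (hfun : ∀ k, h (k + 1) ≤ β * τ k)
    (hupd : ∀ k, τ (k + 1) = (1 - κ) * h (k + 1) + κ * τ k) :
    (∀ k, τ (k + 1) ≤ (1 - (1 - β) * (1 - κ)) * τ k) ∧
      (1 - (1 - β) * (1 - κ)) ∈ Set.Ioo (0 : ℝ) 1 ∧
      Tendsto τ atTop (nhds 0) ∧
      Tendsto h atTop (nhds 0) := by
  obtain ⟨hβ0, hβ1⟩ := hβ
  obtain ⟨hκ0, hκ1⟩ := hκ
  have hτ : ∀ k, 0 ≤ τ k := fun k =>
    nonneg_of_mul_nonneg_right ((hh (k + 1)).trans (hfun k)) hβ0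
  have hstep : ∀ k, τ (k + 1) ≤ (1 - (1 - β) * (1 - κ)) * τ k := by
    intro k
    have h1 := mul_le_mul_of_nonneg_left (hfun k) (sub_nonneg.2 hκ1.le)
    rw [hupd k]
    linarith
  have h0 : 0 < 1 - (1 - β) * (1 - κ) := by nlinarith
  have h1 : 1 - (1 - β) * (1 - κ) < 1 := by
    have := mul_pos (sub_pos.2 hβ1) (sub_pos.2 hκ1)
    linarith
  have hbound : ∀ k, τ k ≤ (1 - (1 - β) * (1 - κ)) ^ k * τ 0 := by
    intro k
    induction k with
    | zero => simp
    | succ k ih =>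
      have h2 := mul_le_mul_of_nonneg_left ih h0.le
      calc τ (k + 1) ≤ _ := hstep k
        _ ≤ _ := h2
        _ = _ := by ring
  have hτlim : Tendsto τ atTop (nhds 0) := by
    refine squeeze_zero hτ hbound ?_
    simpa using (tendsto_pow_atTop_nhds_zero_of_lt_one h0.le h1).mul_const (τ 0)
  refine ⟨hstep, ⟨h0, h1⟩, hτlim, ?_⟩
  rw [← tendsto_add_atTop_iff_nat 1]
  refine squeeze_zero (fun k => hh (k + 1)) hfun ?_
  simpa using hτlim.const_mul β
end
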